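/- Let n ≥ 1 and let V be an algebraic subvariety of (ℂ*)^n, i.e. the set of common zeros in (ℂ*)^n of a family of polynomials in n variables over ℂ. Let π : ℂ^n → (ℂ*)^n be the map applying the complex exponential to each coordinate. Let W be an irreducible algebraic subset of ℂ^n contained in π^{-1}(V) which is maximal among irreducible algebraic subsets of ℂ^n contained in π^{-1}(V) (i.e. any irreducible algebraic subset W' of ℂ^n with W ⊆ W' ⊆ π^{-1}(V) equals W). Then W is a translate of a rational linear subspace: there exist a point a ∈ ℂ^n and a ℚ-linear subspace L of ℚ^n such that W = a + span_ℂ(L), where span_ℂ(L) is the ℂ-linear span in ℂ^n of L. -/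

import Mathlib

/-- A subset of `ℂ^n` is algebraic if it is the set of common zeros of a family of
polynomials in `n` variables over `ℂ`. -/
def IsAlgebraicSet {n : ℕ} (W : Set (Fin n → ℂ)) : Prop :=
  ∃ P : Set (MvPolynomial (Fin n) ℂ),
    W = {z : Fin n → ℂ | ∀ p ∈ P, MvPolynomial.eval z p = 0}

/-- An algebraic subset of `ℂ^n` is irreducible if it is nonempty and is not the union of
two algebraic subsets each properly contained in it. -/
def IsIrreducibleAlgebraicSet {n : ℕ} (W : Set (Fin n → ℂ)) : Prop :=
  IsAlgebraicSet W ∧ W.Nonempty ∧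
    ∀ A B : Set (Fin n → ℂ), IsAlgebraicSet A → IsAlgebraicSet B → W = A ∪ B →
      W = A ∨ W = B


lemma totalDegree_pderiv_le' {σ k : Type*} [CommRing k] (i : σ) (p : MvPolynomial σ k) :
    (MvPolynomial.pderiv i p).totalDegree ≤ p.totalDegree - 1 := by
  classical
  conv_lhs => rw [p.as_sum, map_sum]
  refine (MvPolynomial.totalDegree_finsetSum _ _).trans (Finset.sup_le fun s hs => ?_)
  rw [MvPolynomial.pderiv_monomial]
  by_cases h : s i = 0
  · simp [h]
  · refine (MvPolynomial.totalDegree_monomial_le _ _).trans ?_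
    have h1 := MvPolynomial.le_totalDegree hs
    have h2 : (s - Finsupp.single i 1) + Finsupp.single i 1 = s := by
      apply tsub_add_cancel_of_le
      simpa [Finsupp.single_le_iff] using Nat.one_le_iff_ne_zero.mpr h
    have h3 : (s - Finsupp.single i 1).degree + 1 = s.degree := by
      conv_rhs => rw [← h2, map_add]
      simp
    have h4 : s.degree ≤ p.totalDegree := h1
    have h5 : (s - Finsupp.single i 1).sum (fun _ => id) = (s - Finsupp.single i 1).degree := rfl
    omega

lemma no_log_relation {σ k : Type*} [Field k] [CharZero k] (i : σ) (a b : MvPolynomial σ k)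
    (ha : a ≠ 0) (hb : b ≠ 0) (m : ℕ) (hm : m ≠ 0)
    (h : a * MvPolynomial.pderiv i b - MvPolynomial.pderiv i a * b = - (m * (a * b))) : False := by
  have hm' : (m : MvPolynomial σ k) = MvPolynomial.C (m : k) := by simp
  have hmk : (m : k) ≠ 0 := by exact_mod_cast hm
  have hab : a * b ≠ 0 := mul_ne_zero ha hb
  have hC : (MvPolynomial.C (m : k) : MvPolynomial σ k) ≠ 0 := by simpa using hmk
  have hd : (-((m : MvPolynomial σ k) * (a * b))).totalDegree = a.totalDegree + b.totalDegree := by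
    rw [MvPolynomial.totalDegree_neg, hm', MvPolynomial.totalDegree_mul_of_isDomain hC hab,
      MvPolynomial.totalDegree_mul_of_isDomain ha hb, MvPolynomial.totalDegree_C, zero_add]
  have hne : -((m : MvPolynomial σ k) * (a * b)) ≠ 0 := by
    rw [neg_ne_zero, hm']; exact mul_ne_zero hC hab
  have key : ∀ p : MvPolynomial σ k, p.totalDegree = 0 → MvPolynomial.pderiv i p = 0 := by
    intro p hp
    rw [MvPolynomial.totalDegree_eq_zero_iff_eq_C] at hp
    rw [hp]; simp
  have h1 := MvPolynomial.totalDegree_sub (a * MvPolynomial.pderiv i b) (MvPolynomial.pderiv i a * b)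
  rw [h, hd] at h1
  have h2 := MvPolynomial.totalDegree_mul a (MvPolynomial.pderiv i b)
  have h3 := MvPolynomial.totalDegree_mul (MvPolynomial.pderiv i a) b
  have h4 := totalDegree_pderiv_le' i a
  have h5 := totalDegree_pderiv_le' i b
  rw [← h] at hne
  by_cases hA : a.totalDegree = 0 <;> by_cases hB : b.totalDegree = 0
  · simp [key _ hA, key _ hB] at hne
  · simp only [key _ hA, zero_mul, MvPolynomial.totalDegree_zero] at h1
    simp at h1
    omega
  · simp only [key _ hB, mul_zero, MvPolynomial.totalDegree_zero] at h1
    simp at h1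
    omega
  · rcases le_max_iff.1 h1 with h1 | h1 <;> omega

lemma alg_lemma {σ k K : Type*} [Field k] [CharZero k] [Field K] [Algebra k K]
    [Algebra (MvPolynomial σ k) K] [IsScalarTower k (MvPolynomial σ k) K]
    (hinj : Function.Injective (algebraMap (MvPolynomial σ k) K)) (i : σ)
    (D : Derivation k K K) (hD : ∀ s : MvPolynomial σ k, D (algebraMap _ K s) =
      algebraMap _ K (MvPolynomial.pderiv i s)) (u : K)
    (hu : IsAlgebraic (MvPolynomial σ k) u) (hDu : D u = - u) : u = 0 := by
  classical
  by_contra hu0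
  let P : ℕ → Prop := fun m => ∃ Q : Polynomial (MvPolynomial σ k), Q ≠ 0 ∧
    Polynomial.aeval u Q = 0 ∧ Q.natDegree = m
  have hP : ∃ m, P m := by
    obtain ⟨Q, h1, h2⟩ := hu
    exact ⟨_, Q, h1, h2, rfl⟩
  obtain ⟨Q, hQ0, hQu, hQm⟩ := Nat.find_spec hP
  have hmin : ∀ R : Polynomial (MvPolynomial σ k), Polynomial.aeval u R = 0 →
      R.natDegree < Q.natDegree → R = 0 := by
    intro R hR hlt
    by_contra hR0
    rw [hQm] at hlt
    exact Nat.find_min hP hlt ⟨R, hR0, hR, rfl⟩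
  have hm0 : Q.natDegree ≠ 0 := by
    intro h0
    rw [Polynomial.eq_C_of_natDegree_eq_zero h0] at hQu hQ0
    simp only [Polynomial.aeval_C] at hQu
    apply hQ0
    rw [(injective_iff_map_eq_zero _).1 hinj _ hQu, map_zero]
  have hq0 : Q.coeff 0 ≠ 0 := by
    intro h0
    obtain ⟨R, hR⟩ := Polynomial.X_dvd_iff.2 h0
    have hRne : R ≠ 0 := by rintro rfl; simp at hR; exact hQ0 hR
    apply hRne
    apply hmin
    · rw [hR] at hQu
      simpa [hu0] using hQu
    · rw [hR, Polynomial.natDegree_X_mul hRne]; omega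
  let d : Derivation k (MvPolynomial σ k) (MvPolynomial σ k) := MvPolynomial.pderiv i
  have hsum : ∀ p : Polynomial (MvPolynomial σ k), ∃ q : Polynomial (MvPolynomial σ k),
      D (Polynomial.aeval u p) = Polynomial.aeval u q ∧
        ∀ j, q.coeff j = d (p.coeff j) - j * p.coeff j := by
    intro p
    induction p using Polynomial.induction_on' with
    | add p q hp hq =>
      obtain ⟨p1, h1, h2⟩ := hp
      obtain ⟨q1, h3, h4⟩ := hq
      refine ⟨p1 + q1, by rw [map_add, map_add, map_add, h1, h3], fun j => ?_⟩
      rw [Polynomial.coeff_add, h2, h4, Polynomial.coeff_add, map_add]; ring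
    | monomial m a =>
      refine ⟨Polynomial.monomial m (d a - m * a), ?_, fun j => ?_⟩
      · simp only [Polynomial.aeval_monomial, Derivation.leibniz, Derivation.leibniz_pow, hDu, hD,
          map_sub, map_mul, map_natCast, d, smul_eq_mul, nsmul_eq_mul]
        rcases m with _ | m
        · simp
        · simp; ring
      · rw [Polynomial.coeff_monomial, Polynomial.coeff_monomial]
        split_ifs with h
        · rw [h]
        · simp
  obtain ⟨Q1, hQ1, hc⟩ := hsum Q
  have hQ1u : Polynomial.aeval u Q1 = 0 := by rw [← hQ1, hQu, map_zero]
  have hdeg : Q1.natDegree ≤ Q.natDegree := by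
    rw [Polynomial.natDegree_le_iff_coeff_eq_zero]
    intro N hN
    rw [hc, Polynomial.coeff_eq_zero_of_natDegree_lt hN]; simp
  set m := Q.natDegree with hm
  set T := Polynomial.C (Q.coeff m) * Q1 - Polynomial.C (Q1.coeff m) * Q with hT
  have hTu : Polynomial.aeval u T = 0 := by simp [hT, hQu, hQ1u]
  have hTd : T.natDegree < m := by
    have : T.natDegree ≤ m - 1 := by
      rw [Polynomial.natDegree_le_iff_coeff_eq_zero]
      intro N hN
      rw [hT, Polynomial.coeff_sub, Polynomial.coeff_C_mul, Polynomial.coeff_C_mul]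
      rcases eq_or_ne N m with hNm | hne
      · rw [hNm]; ring
      · rw [Polynomial.coeff_eq_zero_of_natDegree_lt (p := Q) (n := N) (by omega),
          Polynomial.coeff_eq_zero_of_natDegree_lt (p := Q1) (n := N) (by omega)]; simp
    omega
  have hT0 := hmin T hTu hTd
  have h0 : T.coeff 0 = 0 := by rw [hT0]; simp
  rw [hT, Polynomial.coeff_sub, Polynomial.coeff_C_mul, Polynomial.coeff_C_mul, hc, hc] at h0
  refine no_log_relation i (Q.coeff m) (Q.coeff 0) ?_ hq0 m hm0 ?_
  · rw [hm]; exact Polynomial.leadingCoeff_ne_zero.2 hQ0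
  · have : d = MvPolynomial.pderiv i := rfl
    rw [← this]
    push_cast at h0
    linear_combination h0

lemma field_lemma {k K : Type*} [Field k] [CharZero k] [Field K] [Algebra k K] (f : K)
    (hf : Transcendental k f) :
    ∃ D : Derivation k K K, D f = 1 ∧ ∀ u, D u = -u → u = 0 := by
  classical
  have hs : AlgebraicIndepOn k id ({f} : Set K) := by
    have := (algebraicIndependent_unique_type_iff (R := k) (x := fun i : ({f} : Set K) => (i : K))).2
      (by simpa [Set.default_coe_singleton] using hf)
    exact this
  obtain ⟨t, hft, ht⟩ := exists_isTranscendenceBasis_superset hs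
  have hft : f ∈ t := hft rfl
  let alg : Algebra (MvPolynomial t k) K := (MvPolynomial.aeval ((↑) : t → K)).toAlgebra
  have halg : ∀ s, algebraMap (MvPolynomial t k) K s = MvPolynomial.aeval ((↑) : t → K) s := fun s => rfl
  have : IsScalarTower k (MvPolynomial t k) K := IsScalarTower.of_algebraMap_eq (fun x => by
    rw [halg]; simp)
  have hinj : Function.Injective (algebraMap (MvPolynomial t k) K) := ht.1
  have : FaithfulSMul (MvPolynomial t k) K := (faithfulSMul_iff_algebraMap_injective _ _).2 hinj
  have : Algebra.IsAlgebraic (MvPolynomial t k) K := by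
    have := ht.isAlgebraic
    exact Algebra.IsAlgebraic.of_ringHom_of_comp_eq (ht.1.aevalEquiv) (RingHom.id K)
      (ht.1.aevalEquiv.surjective) Function.injective_id (by
        ext x <;> simp [halg])
  let : Algebra (FractionRing (MvPolynomial t k)) K := FractionRing.liftAlgebra _ K
  have : IsScalarTower (MvPolynomial t k) (FractionRing (MvPolynomial t k)) K := inferInstance
  have : Algebra.IsAlgebraic (FractionRing (MvPolynomial t k)) K := by
    exact (IsFractionRing.comap_isAlgebraic_iff (A := MvPolynomial t k)).1 inferInstance
  have : CharZero (FractionRing (MvPolynomial t k)) := inferInstance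
  have : Algebra.IsSeparable (FractionRing (MvPolynomial t k)) K := inferInstance
  have : Algebra.FormallyEtale (FractionRing (MvPolynomial t k)) K := Algebra.FormallyEtale.of_isSeparable _ _
  have : Algebra.FormallyEtale (MvPolynomial t k) (FractionRing (MvPolynomial t k)) :=
    Algebra.FormallyEtale.of_isLocalization (nonZeroDivisors _)
  have : Algebra.FormallyEtale (MvPolynomial t k) K :=
    Algebra.FormallyEtale.comp _ (FractionRing (MvPolynomial t k)) _
  let d : Derivation k (MvPolynomial t k) K := MvPolynomial.mkDerivation k
    (fun j : t => if j = ⟨f, hft⟩ then (1 : K) else 0)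
  let D : Derivation k K K := ((d.liftKaehlerDifferential.liftBaseChange K).comp
    (KaehlerDifferential.tensorKaehlerEquivOfFormallyEtale k (MvPolynomial t k) K).symm.toLinearMap).compDer
      (KaehlerDifferential.D k K)
  have hD : ∀ s, D (algebraMap _ K s) = d s := by
    intro s
    change (d.liftKaehlerDifferential.liftBaseChange K)
      ((KaehlerDifferential.tensorKaehlerEquivOfFormallyEtale k (MvPolynomial t k) K).symm
        (KaehlerDifferential.D k K (algebraMap _ K s))) = d s
    rw [KaehlerDifferential.tensorKaehlerEquivOfFormallyEtale_symm_D_algebraMap]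
    simp
  have hd : ∀ s, d s = algebraMap _ K (MvPolynomial.pderiv (⟨f, hft⟩ : t) s) := by
    intro s
    have : d = ((Algebra.linearMap (MvPolynomial t k) K).compDer (MvPolynomial.pderiv (⟨f, hft⟩ : t))) := by
      apply MvPolynomial.derivation_ext
      intro j
      change d (MvPolynomial.X j) = algebraMap (MvPolynomial t k) K
        (MvPolynomial.pderiv (⟨f, hft⟩ : t) (MvPolynomial.X j))
      simp only [d, MvPolynomial.mkDerivation_X, MvPolynomial.pderiv_X]
      by_cases hj : j = ⟨f, hft⟩
      · subst hj; simp
      · simp [hj]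
    rw [this]; rfl
  refine ⟨D, ?_, ?_⟩
  · have : f = algebraMap (MvPolynomial t k) K (MvPolynomial.X ⟨f, hft⟩) := by rw [halg]; simp
    rw [this, hD, hd]; simp
  · intro u hu
    exact alg_lemma hinj ⟨f, hft⟩ D (fun s => by rw [hD, hd]) u (Algebra.IsAlgebraic.isAlgebraic u) hu

lemma exists_vector_field {n : ℕ} (I : Ideal (MvPolynomial (Fin n) ℂ)) [I.IsPrime]
    (f g₁ g₂ : MvPolynomial (Fin n) ℂ) (hf : ∀ c : ℂ, f - MvPolynomial.C c ∉ I)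
    (h₁ : g₁ ∉ I) (h₂ : g₂ ∉ I) :
    ∃ v : Fin n → MvPolynomial (Fin n) ℂ,
      (∀ p ∈ I, MvPolynomial.mkDerivation ℂ v p ∈ I) ∧
      g₁ * MvPolynomial.mkDerivation ℂ v g₂ - g₂ * MvPolynomial.mkDerivation ℂ v g₁
        + g₁ * g₂ * MvPolynomial.mkDerivation ℂ v f ∉ I := by
  classical
  let A := MvPolynomial (Fin n) ℂ ⧸ I
  let K := FractionRing A
  let φ : MvPolynomial (Fin n) ℂ →+* K := (algebraMap A K).comp (Ideal.Quotient.mk I)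
  have hφ : ∀ p, φ p = 0 ↔ p ∈ I := by
    intro p
    simp only [φ, RingHom.comp_apply]
    rw [map_eq_zero_iff _ (IsFractionRing.injective A K), Ideal.Quotient.eq_zero_iff_mem]
  have hC : ∀ c, φ (MvPolynomial.C c) = algebraMap ℂ K c := fun c => rfl
  have htr : Transcendental ℂ (φ f) := by
    intro halg
    have hIntg : IsIntegral ℂ (φ f) := halg.isIntegral
    have h1 := IsAlgClosed.degree_eq_one_of_irreducible ℂ (minpoly.irreducible hIntg)
    obtain ⟨c, hc⟩ := minpoly.mem_range_of_degree_eq_one ℂ (φ f) h1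
    apply hf c
    rw [← hφ, map_sub, hC, hc, sub_self]
  obtain ⟨D, hD1, hD⟩ := field_lemma (φ f) htr
  obtain ⟨b, hb⟩ := IsLocalization.exist_integer_multiples_of_finite (nonZeroDivisors A)
    (fun j : Fin n => D (φ (MvPolynomial.X j)))
  obtain ⟨h, hh⟩ := Ideal.Quotient.mk_surjective (b : A)
  have hh0 : φ h ≠ 0 := by
    simp only [φ, RingHom.comp_apply, hh]
    rw [Ne, map_eq_zero_iff _ (IsFractionRing.injective A K)]
    exact nonZeroDivisors.coe_ne_zero b
  have hv : ∀ j, ∃ v, φ v = φ h * D (φ (MvPolynomial.X j)) := by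
    intro j
    obtain ⟨a, ha⟩ := hb j
    obtain ⟨v, hv⟩ := Ideal.Quotient.mk_surjective a
    refine ⟨v, ?_⟩
    simp only [φ, RingHom.comp_apply, hh, hv] at *
    rw [ha, Algebra.smul_def]
  choose v hv using hv
  have key : ∀ p, φ (MvPolynomial.mkDerivation ℂ v p) = φ h * D (φ p) := by
    intro p
    induction p using MvPolynomial.induction_on with
    | C a => rw [hC]; simp
    | add p q hp hq => simp only [map_add, hp, hq]; ring
    | mul_X p i hp =>
      simp only [Derivation.leibniz, map_add, map_mul, smul_eq_mul, hp, MvPolynomial.mkDerivation_X, hv]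
      ring
  refine ⟨v, ?_, ?_⟩
  · intro p hp
    rw [← hφ, key, (hφ p).2 hp]; simp
  · rw [← hφ] at h₁ h₂ ⊢
    simp only [map_add, map_sub, map_mul, key, hD1]
    set u := φ g₂ / φ g₁ with hu
    have hu0 : u ≠ 0 := div_ne_zero h₂ h₁
    have hg : φ g₂ = u * φ g₁ := by rw [hu, div_mul_cancel₀ _ h₁]
    have hDg : D (φ g₂) = u * D (φ g₁) + φ g₁ * D u := by rw [hg, Derivation.leibniz]; simp
    intro h0
    apply hu0
    apply hD
    have : φ h * φ g₁ ^ 2 * (D u + u) = 0 := by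
      rw [hDg, hg] at h0
      linear_combination h0
    have := (mul_eq_zero.1 this).resolve_left (mul_ne_zero hh0 (pow_ne_zero _ h₁))
    linear_combination this

lemma hasDerivAt_eval {n : ℕ} (v : Fin n → MvPolynomial (Fin n) ℂ) (γ : ℝ → Fin n → ℂ) (t : ℝ)
    (hγ : HasDerivAt γ (fun j => MvPolynomial.eval (γ t) (v j)) t) (p : MvPolynomial (Fin n) ℂ) :
    HasDerivAt (fun s => MvPolynomial.eval (γ s) p)
      (MvPolynomial.eval (γ t) (MvPolynomial.mkDerivation ℂ v p)) t := by
  induction p using MvPolynomial.induction_on with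
  | C a => simpa using hasDerivAt_const t a
  | add p q hp hq =>
    simp only [map_add]
    exact hp.fun_add hq
  | mul_X p i hp =>
    have h1 := hp.fun_mul ((hasDerivAt_pi.1 hγ) i)
    simp only [map_mul, MvPolynomial.eval_X, Derivation.leibniz, map_add, smul_eq_mul,
      MvPolynomial.mkDerivation_X]
    exact h1.congr_deriv (by ring)

lemma contDiff_eval {n : ℕ} (p : MvPolynomial (Fin n) ℂ) :
    ContDiff ℝ 1 (fun x : Fin n → ℂ => MvPolynomial.eval x p) := by
  induction p using MvPolynomial.induction_on with
  | C a => simpa using contDiff_const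
  | add p q hp hq => simpa using hp.add hq
  | mul_X p i hp => simpa using hp.mul (contDiff_apply ℝ ℂ i)

lemma exists_flow {n : ℕ} (I : Ideal (MvPolynomial (Fin n) ℂ))
    (v : Fin n → MvPolynomial (Fin n) ℂ) (hv : ∀ p ∈ I, MvPolynomial.mkDerivation ℂ v p ∈ I)
    (w : Fin n → ℂ) (hw : ∀ p ∈ I, MvPolynomial.eval w p = 0) :
    ∃ γ : ℝ → Fin n → ℂ, γ 0 = w ∧ HasDerivAt γ (fun j => MvPolynomial.eval (γ 0) (v j)) 0 ∧
      ∃ ε > 0, ∀ t ∈ Set.Icc 0 ε, ∀ p ∈ I, MvPolynomial.eval (γ t) p = 0 := by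
  classical
  have hcd : ContDiff ℝ 1 (fun x : Fin n → ℂ => fun j => MvPolynomial.eval x (v j)) :=
    contDiff_pi.2 fun j => contDiff_eval (v j)
  obtain ⟨γ, hγ0, ε, hε, hγ⟩ :=
    (hcd.contDiffAt (x := w)).exists_forall_mem_closedBall_exists_eq_forall_mem_Ioo_hasDerivAt₀ 0
  refine ⟨γ, hγ0, hγ 0 (by constructor <;> linarith), ε / 2, by linarith, ?_⟩
  have hγ' : ∀ t ∈ Set.Icc 0 (ε / 2), HasDerivAt γ (fun j => MvPolynomial.eval (γ t) (v j)) t :=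
    fun t ht => hγ t ⟨by linarith [ht.1], by linarith [ht.2]⟩
  have hcont : ContinuousOn γ (Set.Icc 0 (ε / 2)) :=
    fun t ht => (hγ' t ht).continuousAt.continuousWithinAt
  obtain ⟨G, hG⟩ := (isNoetherianRing_iff_ideal_fg _).1 inferInstance I
  have hrel : ∀ i : G, ∃ h : G → MvPolynomial (Fin n) ℂ,
      MvPolynomial.mkDerivation ℂ v (i : MvPolynomial (Fin n) ℂ) = ∑ j : G, h j * (j : MvPolynomial (Fin n) ℂ) := by
    intro i
    have h1 : MvPolynomial.mkDerivation ℂ v (i : MvPolynomial (Fin n) ℂ) ∈ Ideal.span (G : Set (MvPolynomial (Fin n) ℂ)) := by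
      have : Ideal.span (G : Set (MvPolynomial (Fin n) ℂ)) = I := hG
      rw [this]
      exact hv _ (this ▸ Ideal.subset_span i.2)
    have h2 : Set.range (fun j : G => (j : MvPolynomial (Fin n) ℂ)) = (G : Set (MvPolynomial (Fin n) ℂ)) := by
      ext; simp
    rw [← h2, Ideal.mem_span_range_iff_exists_fun] at h1
    obtain ⟨c, hc⟩ := h1
    exact ⟨c, hc.symm⟩
  choose h hh using hrel
  let y : ℝ → (G → ℂ) := fun t i => MvPolynomial.eval (γ t) (i : MvPolynomial (Fin n) ℂ)
  let y' : ℝ → (G → ℂ) := fun t i => MvPolynomial.eval (γ t)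
    (MvPolynomial.mkDerivation ℂ v (i : MvPolynomial (Fin n) ℂ))
  have hy : ∀ t ∈ Set.Icc 0 (ε / 2), HasDerivAt y (y' t) t := fun t ht =>
    hasDerivAt_pi.2 fun i => hasDerivAt_eval v γ t (hγ' t ht) _
  have hH : ContinuousOn (fun t => ∑ i : G, ∑ j : G, ‖MvPolynomial.eval (γ t) (h i j)‖)
      (Set.Icc 0 (ε / 2)) := by
    refine continuousOn_finsetSum _ fun i _ => continuousOn_finsetSum _ fun j _ => ?_
    exact ((contDiff_eval (h i j)).continuous.comp_continuousOn hcont).norm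
  obtain ⟨B, hB⟩ := (isCompact_Icc.bddAbove_image hH)
  have hy0 := eq_zero_of_abs_deriv_le_mul_abs_self_of_eq_zero_right (f := y) (f' := y') (K := B)
    (a := 0) (b := ε / 2) (fun t ht => (hy t ht).continuousAt.continuousWithinAt)
    (fun t ht => (hy t ⟨ht.1, ht.2.le⟩).hasDerivWithinAt)
    (by
      funext i
      simp only [y, hγ0]
      exact hw _ (hG ▸ Ideal.subset_span i.2)) (by
      intro t ht
      have hBt : ∑ i : G, ∑ j : G, ‖MvPolynomial.eval (γ t) (h i j)‖ ≤ B :=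
        hB ⟨t, ⟨ht.1, ht.2.le⟩, rfl⟩
      have hB0 : 0 ≤ B := le_trans (by positivity) hBt
      rw [pi_norm_le_iff_of_nonneg (by positivity)]
      intro i
      simp only [y', hh, map_sum, map_mul]
      calc ‖∑ j : G, MvPolynomial.eval (γ t) (h i j) * MvPolynomial.eval (γ t) (j : MvPolynomial (Fin n) ℂ)‖
          ≤ ∑ j : G, ‖MvPolynomial.eval (γ t) (h i j)‖ * ‖y t‖ := by
            refine (norm_sum_le _ _).trans (Finset.sum_le_sum fun j _ => ?_)
            rw [norm_mul]
            gcongr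
            exact norm_le_pi_norm (y t) j
        _ = (∑ j : G, ‖MvPolynomial.eval (γ t) (h i j)‖) * ‖y t‖ := by rw [Finset.sum_mul]
        _ ≤ B * ‖y t‖ := by
            gcongr
            refine le_trans ?_ hBt
            exact Finset.single_le_sum (f := fun i => ∑ j : G, ‖MvPolynomial.eval (γ t) (h i j)‖)
              (fun _ _ => by positivity) (Finset.mem_univ i))
  intro t ht p hp
  have hle : I ≤ RingHom.ker (MvPolynomial.eval (γ t)) := by
    have : Ideal.span (G : Set (MvPolynomial (Fin n) ℂ)) = I := hG
    rw [← this, Ideal.span_le]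
    intro q hq
    exact congrFun (hy0 t ht) ⟨q, hq⟩
  exact hle hp

lemma relation_deriv {n : ℕ} {ι : Type*} (s : Finset ι) (W : Set (Fin n → ℂ))
    (I : Ideal (MvPolynomial (Fin n) ℂ))
    (hWI : ∀ w, w ∈ W ↔ ∀ p ∈ I, MvPolynomial.eval w p = 0)
    (v : Fin n → MvPolynomial (Fin n) ℂ) (hv : ∀ p ∈ I, MvPolynomial.mkDerivation ℂ v p ∈ I)
    (f g : ι → MvPolynomial (Fin n) ℂ)
    (h : ∀ w ∈ W, ∑ i ∈ s, MvPolynomial.eval w (g i) * Complex.exp (MvPolynomial.eval w (f i)) = 0) :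
    ∀ w ∈ W, ∑ i ∈ s, MvPolynomial.eval w (MvPolynomial.mkDerivation ℂ v (g i) +
      g i * MvPolynomial.mkDerivation ℂ v (f i)) * Complex.exp (MvPolynomial.eval w (f i)) = 0 := by
  intro w hw
  obtain ⟨γ, hγ0, hγ, ε, hε, hγI⟩ := exists_flow I v hv w ((hWI w).1 hw)
  have hd : HasDerivAt (fun t => ∑ i ∈ s, MvPolynomial.eval (γ t) (g i) *
      Complex.exp (MvPolynomial.eval (γ t) (f i)))
      (∑ i ∈ s, MvPolynomial.eval w (MvPolynomial.mkDerivation ℂ v (g i) +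
      g i * MvPolynomial.mkDerivation ℂ v (f i)) * Complex.exp (MvPolynomial.eval w (f i))) 0 := by
    refine HasDerivAt.fun_sum fun i _ => ?_
    have h1 := hasDerivAt_eval v γ 0 hγ (g i)
    have h2 := (hasDerivAt_eval v γ 0 hγ (f i)).cexp
    refine (h1.fun_mul h2).congr_deriv ?_
    rw [hγ0]
    simp only [map_add, map_mul]
    ring
  have hd2 : HasDerivWithinAt (fun t => ∑ i ∈ s, MvPolynomial.eval (γ t) (g i) *
      Complex.exp (MvPolynomial.eval (γ t) (f i))) 0 (Set.Icc 0 ε) 0 := by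
    refine (hasDerivWithinAt_const (0 : ℝ) (Set.Icc 0 ε) (0 : ℂ)).congr_of_mem ?_ ⟨le_rfl, hε.le⟩
    intro t ht
    exact h _ ((hWI _).2 (hγI t ht))
  exact (uniqueDiffOn_Icc hε 0 ⟨le_rfl, hε.le⟩).eq_deriv _ hd.hasDerivWithinAt hd2

lemma exp_indep {n : ℕ} {ι : Type*} (W : Set (Fin n → ℂ))
    (I : Ideal (MvPolynomial (Fin n) ℂ)) [I.IsPrime]
    (hWI : ∀ w, w ∈ W ↔ ∀ p ∈ I, MvPolynomial.eval w p = 0)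
    (hIW : ∀ p, p ∈ I ↔ ∀ w ∈ W, MvPolynomial.eval w p = 0)
    (f : ι → MvPolynomial (Fin n) ℂ) (s : Finset ι)
    (hf : ∀ i ∈ s, ∀ j ∈ s, i ≠ j → ∀ c : ℂ, f i - f j - MvPolynomial.C c ∉ I) :
    ∀ g : ι → MvPolynomial (Fin n) ℂ,
    (∀ w ∈ W, ∑ i ∈ s, MvPolynomial.eval w (g i) * Complex.exp (MvPolynomial.eval w (f i)) = 0) →
    ∀ i ∈ s, g i ∈ I := by
  classical
  induction s using Finset.induction_on with
  | empty => intro g _ i hi; simp at hi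
  | insert a s ha ih =>
    intro g hg
    have ih' := ih (fun i hi j hj => hf i (Finset.mem_insert_of_mem hi) j (Finset.mem_insert_of_mem hj))
    by_cases hga : g a ∈ I
    · intro i hi
      rcases Finset.mem_insert.1 hi with rfl | hi
      · exact hga
      · refine ih' g (fun w hw => ?_) i hi
        have := hg w hw
        rw [Finset.sum_insert ha, (hIW _).1 hga w hw] at this
        simpa using this
    exfalso
    by_cases hall : ∀ i ∈ s, g i ∈ I
    · apply hga
      rw [hIW]
      intro w hw
      have := hg w hw
      rw [Finset.sum_insert ha, Finset.sum_eq_zero (fun i hi => by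
        rw [(hIW _).1 (hall i hi) w hw, zero_mul]), add_zero] at this
      exact (mul_eq_zero.1 this).resolve_right (Complex.exp_ne_zero _)
    push Not at hall
    obtain ⟨b, hb, hgb⟩ := hall
    obtain ⟨v, hvI, hv⟩ := exists_vector_field I (f b - f a) (g a) (g b)
      (hf b (Finset.mem_insert_of_mem hb) a (Finset.mem_insert_self _ _)
        (by rintro rfl; exact ha hb)) hga hgb
    have hder := relation_deriv (insert a s) W I hWI v hvI f g hg
    set D := MvPolynomial.mkDerivation ℂ v
    have hnew := ih' (fun i => g a * (D (g i) + g i * D (f i)) - (D (g a) + g a * D (f a)) * g i) (by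
      intro w hw
      have h1 := hg w hw
      have h2 := hder w hw
      rw [Finset.sum_insert ha] at h1 h2
      have h3 : ∑ i ∈ s, MvPolynomial.eval w (g a * (D (g i) + g i * D (f i)) - (D (g a) + g a * D (f a)) * g i)
          * Complex.exp (MvPolynomial.eval w (f i)) =
          MvPolynomial.eval w (g a) * ∑ i ∈ s, MvPolynomial.eval w (D (g i) + g i * D (f i)) * Complex.exp (MvPolynomial.eval w (f i))
          - MvPolynomial.eval w (D (g a) + g a * D (f a)) * ∑ i ∈ s, MvPolynomial.eval w (g i) * Complex.exp (MvPolynomial.eval w (f i)) := by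
        rw [Finset.mul_sum, Finset.mul_sum, ← Finset.sum_sub_distrib]
        refine Finset.sum_congr rfl fun i _ => ?_
        rw [map_sub, map_mul, map_mul]; ring
      rw [h3]
      linear_combination MvPolynomial.eval w (g a) * h2 - MvPolynomial.eval w (D (g a) + g a * D (f a)) * h1) b hb
    apply hv
    convert hnew using 1
    rw [map_sub]; ring

lemma vanishing_prime {n : ℕ} (W : Set (Fin n → ℂ)) (hW : IsIrreducibleAlgebraicSet W) :
    ∃ I : Ideal (MvPolynomial (Fin n) ℂ), I.IsPrime ∧
      (∀ w, w ∈ W ↔ ∀ p ∈ I, MvPolynomial.eval w p = 0) ∧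
      (∀ p, p ∈ I ↔ ∀ w ∈ W, MvPolynomial.eval w p = 0) := by
  obtain ⟨⟨P, hP⟩, ⟨a, ha⟩, hirr⟩ := hW
  have hIW : ∀ p, p ∈ MvPolynomial.vanishingIdeal ℂ W ↔ ∀ w ∈ W, MvPolynomial.eval w p = 0 := by
    intro p
    rw [MvPolynomial.mem_vanishingIdeal_iff]
    simp [MvPolynomial.coe_aeval_eq_eval]
  have halg : ∀ p, IsAlgebraicSet (W ∩ {z | MvPolynomial.eval z p = 0}) := by
    intro p
    refine ⟨insert p P, ?_⟩
    ext z
    simp only [hP, Set.mem_inter_iff, Set.mem_setOf_eq, Set.mem_insert_iff, forall_eq_or_imp]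
    tauto
  refine ⟨MvPolynomial.vanishingIdeal ℂ W, ⟨?_, ?_⟩, ?_, hIW⟩
  · rw [Ne, Ideal.eq_top_iff_one, hIW]
    intro h
    simpa using h a ha
  · intro p q hpq
    rw [hIW] at hpq
    have := hirr _ _ (halg p) (halg q) (by
      ext z
      constructor
      · intro hz
        have := hpq z hz
        rw [map_mul, mul_eq_zero] at this
        exact this.imp (fun h => ⟨hz, h⟩) (fun h => ⟨hz, h⟩)
      · rintro (h | h) <;> exact h.1)
    rw [hIW, hIW]
    refine this.imp ?_ ?_ <;>
    · intro h w hw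
      rw [h] at hw
      exact hw.2
  · intro w
    constructor
    · intro hw p hp
      exact (hIW p).1 hp w hw
    · intro h
      rw [hP]
      intro p hp
      refine h p ((hIW p).2 fun z hz => ?_)
      rw [hP] at hz
      exact hz p hp

lemma affine_irreducible {n : ℕ} (S : Set (Fin n → ℂ)) (hS : IsAlgebraicSet S) (hne : S.Nonempty)
    (hline : ∀ x ∈ S, ∀ y ∈ S, ∀ t : ℂ, (fun i => x i + t * (y i - x i)) ∈ S) :
    IsIrreducibleAlgebraicSet S := by
  refine ⟨hS, hne, ?_⟩
  rintro A B ⟨P, hA⟩ ⟨Q, hB⟩ hAB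
  by_contra hcon
  push Not at hcon
  obtain ⟨h1, h2⟩ := hcon
  have hx : ∃ x ∈ S, x ∉ A := by
    by_contra h
    push Not at h
    exact h1 (Set.Subset.antisymm h (hAB ▸ Set.subset_union_left))
  have hy : ∃ x ∈ S, x ∉ B := by
    by_contra h
    push Not at h
    exact h2 (Set.Subset.antisymm h (hAB ▸ Set.subset_union_right))
  obtain ⟨x, hxS, hxA⟩ := hx
  obtain ⟨y, hyS, hyB⟩ := hy
  rw [hA] at hxA
  rw [hB] at hyB
  simp only [Set.mem_setOf_eq, not_forall] at hxA hyB
  obtain ⟨p, hp, hpx⟩ := hxA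
  obtain ⟨q, hq, hqy⟩ := hyB
  let ℓ : Fin n → Polynomial ℂ := fun i => Polynomial.C (x i) + Polynomial.X * Polynomial.C (y i - x i)
  have hℓ : ∀ (r : MvPolynomial (Fin n) ℂ) (t : ℂ), Polynomial.eval t (MvPolynomial.aeval ℓ r) =
      MvPolynomial.eval (fun i => x i + t * (y i - x i)) r := by
    intro r t
    induction r using MvPolynomial.induction_on with
    | C a => simp
    | add r s hr hs => simp only [map_add, Polynomial.eval_add, hr, hs]
    | mul_X r i hr => simp only [map_mul, Polynomial.eval_mul, hr]; simp [ℓ]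
  have hzero : MvPolynomial.aeval ℓ p * MvPolynomial.aeval ℓ q = 0 := by
    apply Polynomial.funext
    intro t
    rw [Polynomial.eval_mul, hℓ, hℓ, Polynomial.eval_zero]
    have := hline x hxS y hyS t
    rw [hAB] at this
    rcases this with h | h
    · rw [hA] at h; rw [h p hp, zero_mul]
    · rw [hB] at h; rw [h q hq, mul_zero]
  rcases mul_eq_zero.1 hzero with h | h
  · apply hpx
    have := hℓ p 0
    rw [h] at this
    simpa using this.symm
  · apply hqy
    have := hℓ q 1
    rw [h] at this
    simpa using this.symm

lemma span_rational {n : ℕ} (Λ : Set (Fin n → ℚ)) (L : Submodule ℚ (Fin n → ℚ))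
    (hL : ∀ q, q ∈ L ↔ ∀ l ∈ Λ, ∑ i, l i * q i = 0) (x : Fin n → ℂ) :
    x ∈ Submodule.span ℂ ((fun q : Fin n → ℚ => fun i => (q i : ℂ)) '' (L : Set (Fin n → ℚ))) ↔
      ∀ l ∈ Λ, ∑ i, (l i : ℂ) * x i = 0 := by
  classical
  constructor
  · intro hx l hl
    induction hx using Submodule.span_induction with
    | mem x hx =>
      obtain ⟨q, hq, rfl⟩ := hx
      have := (hL q).1 hq l hl
      beta_reduce
      exact_mod_cast this
    | zero => simp
    | add x y _ _ hx hy => simp [mul_add, Finset.sum_add_distrib, hx, hy]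
    | smul c x _ hx =>
      have : ∑ i, (l i : ℂ) * (c • x) i = c * ∑ i, (l i : ℂ) * x i := by
        rw [Finset.mul_sum]
        refine Finset.sum_congr rfl fun i _ => ?_
        simp only [Pi.smul_apply, smul_eq_mul]; ring
      rw [this, hx, mul_zero]
  · intro hx
    let e := Module.Basis.ofVectorSpace ℚ ℂ
    let T : Finset _ := Finset.univ.biUnion (fun i => (e.repr (x i)).support)
    have hsum : ∀ i, x i = ∑ b ∈ T, (e.repr (x i) b : ℂ) * e b := by
      intro i
      conv_lhs => rw [← e.linearCombination_repr (x i)]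
      rw [Finsupp.linearCombination_apply, Finsupp.sum_of_support_subset (s := T)]
      · simp [Algebra.smul_def]
      · exact Finset.subset_biUnion_of_mem (fun i => (e.repr (x i)).support) (Finset.mem_univ i)
      · simp
    have hmem : ∀ b, (fun i => e.repr (x i) b) ∈ L := by
      intro b
      rw [hL]
      intro l hl
      have h1 : e.repr (∑ i, (l i : ℂ) * x i) b = ∑ i, l i * e.repr (x i) b := by
        rw [map_sum, Finsupp.finsetSum_apply]
        refine Finset.sum_congr rfl fun i _ => ?_
        have : (l i : ℂ) * x i = l i • x i := by rw [Algebra.smul_def]; simp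
        rw [this, map_smul]; simp
      rw [← h1, hx l hl]; simp
    have hx' : x = ∑ b ∈ T, e b • (fun i => (e.repr (x i) b : ℂ)) := by
      funext i
      rw [Finset.sum_apply]
      conv_lhs => rw [hsum i]
      refine Finset.sum_congr rfl fun b _ => ?_
      simp only [Pi.smul_apply, smul_eq_mul]; ring
    rw [hx']
    refine Submodule.sum_mem _ fun b _ => Submodule.smul_mem _ _ (Submodule.subset_span ?_)
    exact ⟨_, hmem b, rfl⟩

lemma eval_exp {n : ℕ} (p : MvPolynomial (Fin n) ℂ) (a z : Fin n → ℂ) :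
    MvPolynomial.eval (fun i => Complex.exp (z i)) p = ∑ m ∈ p.support,
      (p.coeff m * Complex.exp (∑ i, (m i : ℂ) * a i)) *
        Complex.exp (∑ i, (m i : ℂ) * (z i - a i)) := by
  rw [MvPolynomial.eval_eq']
  refine Finset.sum_congr rfl fun m _ => ?_
  rw [mul_assoc, ← Complex.exp_add, ← Finset.sum_add_distrib, Complex.exp_sum]
  congr 1
  refine Finset.prod_congr rfl fun i _ => ?_
  rw [← Complex.exp_nat_mul]
  congr 1
  ring

lemma vanish_on_hull {n : ℕ} (W : Set (Fin n → ℂ)) (hW : IsIrreducibleAlgebraicSet W)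
    (a : Fin n → ℂ) (ha : a ∈ W) (p : MvPolynomial (Fin n) ℂ)
    (hp : ∀ w ∈ W, MvPolynomial.eval (fun i => Complex.exp (w i)) p = 0) (z : Fin n → ℂ)
    (hz : ∀ l : Fin n → ℚ, (∀ w ∈ W, ∑ i, (l i : ℂ) * (w i - a i) = 0) →
      ∑ i, (l i : ℂ) * (z i - a i) = 0) :
    MvPolynomial.eval (fun i => Complex.exp (z i)) p = 0 := by
  classical
  obtain ⟨I, hI, hWI, hIW⟩ := vanishing_prime W hW
  let φ : (Fin n →₀ ℕ) → (W → ℂ) := fun m w => ∑ i, (m i : ℂ) * ((w : Fin n → ℂ) i - a i)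
  let F : (Fin n →₀ ℕ) → MvPolynomial (Fin n) ℂ := fun m =>
    ∑ i, MvPolynomial.C (m i : ℂ) * (MvPolynomial.X i - MvPolynomial.C (a i))
  have hF : ∀ m (w : Fin n → ℂ), MvPolynomial.eval w (F m) = ∑ i, (m i : ℂ) * (w i - a i) := by
    intro m w
    simp only [F, map_sum, map_mul, map_sub, MvPolynomial.eval_C, MvPolynomial.eval_X]
  let ρ : (W → ℂ) → (Fin n →₀ ℕ) := Function.invFun φ
  have hρ : ∀ m, φ (ρ (φ m)) = φ m := fun m => Function.invFun_eq ⟨m, rfl⟩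
  let T : Finset (W → ℂ) := p.support.image φ
  let b : (W → ℂ) → ℂ := fun κ => ∑ m ∈ p.support with φ m = κ,
    p.coeff m * Complex.exp (∑ i, (m i : ℂ) * a i)
  have hρT : ∀ κ ∈ T, φ (ρ κ) = κ := by
    intro κ hκ
    obtain ⟨m, _, rfl⟩ := Finset.mem_image.1 hκ
    exact hρ m
  -- evaluation at any point of the hull
  have heval : ∀ y : Fin n → ℂ, (∀ m m', φ m = φ m' →
      ∑ i, (m i : ℂ) * (y i - a i) = ∑ i, (m' i : ℂ) * (y i - a i)) →
      MvPolynomial.eval (fun i => Complex.exp (y i)) p =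
        ∑ κ ∈ T, b κ * Complex.exp (∑ i, (ρ κ i : ℂ) * (y i - a i)) := by
    intro y hy
    rw [eval_exp p a y, ← Finset.sum_fiberwise_of_maps_to (t := T) (g := φ)
      (fun m hm => Finset.mem_image_of_mem φ hm)]
    refine Finset.sum_congr rfl fun κ hκ => ?_
    rw [Finset.sum_mul]
    refine Finset.sum_congr rfl fun m hm => ?_
    rw [Finset.mem_filter] at hm
    rw [hy m (ρ κ) (by rw [hρT κ hκ, hm.2])]
  have hb := exp_indep W I hWI hIW (fun κ => F (ρ κ)) T (by
    intro κ hκ κ' hκ' hne c hc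
    apply hne
    rw [← hρT κ hκ, ← hρT κ' hκ']
    rw [hIW] at hc
    have hca : c = 0 := by
      have := hc a ha
      simp only [map_sub, hF, MvPolynomial.eval_C] at this
      simpa using this
    funext w
    have := hc w w.2
    simp only [map_sub, hF, MvPolynomial.eval_C, hca, sub_zero] at this
    exact sub_eq_zero.1 this) (fun κ => MvPolynomial.C (b κ)) (by
    intro w hw
    have h1 := heval w (fun m m' h => congrFun h ⟨w, hw⟩)
    rw [hp w hw] at h1
    rw [h1]
    simp only [MvPolynomial.eval_C, hF])
  have hb0 : ∀ κ ∈ T, b κ = 0 := by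
    intro κ hκ
    have := (hIW _).1 (hb κ hκ) a ha
    simpa using this
  rw [heval z, Finset.sum_eq_zero]
  · intro κ hκ
    rw [hb0 κ hκ, zero_mul]
  · intro m m' h
    have := hz (fun i => (m i : ℚ) - (m' i : ℚ)) (by
      intro w hw
      have := congrFun h ⟨w, hw⟩
      simp only [φ] at this
      push_cast
      simp only [sub_mul, Finset.sum_sub_distrib]
      rw [this, sub_self])
    push_cast at this
    simp only [sub_mul, Finset.sum_sub_distrib] at this
    exact sub_eq_zero.1 this

theorem ax_lindemann_exponential (n : ℕ) (hn : 1 ≤ n) (V : Set (Fin n → ℂ))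
    (hV : ∃ P : Set (MvPolynomial (Fin n) ℂ),
      V = {z : Fin n → ℂ | (∀ i, z i ≠ 0) ∧ ∀ p ∈ P, MvPolynomial.eval z p = 0})
    (W : Set (Fin n → ℂ))
    (hW : IsIrreducibleAlgebraicSet W)
    (hWV : W ⊆ {z : Fin n → ℂ | (fun i => Complex.exp (z i)) ∈ V})
    (hmax : ∀ W' : Set (Fin n → ℂ), IsIrreducibleAlgebraicSet W' → W ⊆ W' →
      W' ⊆ {z : Fin n → ℂ | (fun i => Complex.exp (z i)) ∈ V} → W' = W) :
    ∃ (a : Fin n → ℂ) (L : Submodule ℚ (Fin n → ℚ)),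
      W = (fun v => a + v) ''
        (Submodule.span ℂ ((fun q : Fin n → ℚ => fun i => (q i : ℂ)) ''
          (L : Set (Fin n → ℚ))) : Set (Fin n → ℂ)) := by
  obtain ⟨P, rfl⟩ := hV
  obtain ⟨a, ha⟩ := hW.2.1
  let Λ : Set (Fin n → ℚ) := {l | ∀ w ∈ W, ∑ i, (l i : ℂ) * (w i - a i) = 0}
  let L : Submodule ℚ (Fin n → ℚ) :=
    { carrier := {q | ∀ l ∈ Λ, ∑ i, l i * q i = 0}
      add_mem' := by
        intro x y hx hy l hl
        simp only [Pi.add_apply, mul_add, Finset.sum_add_distrib]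
        rw [hx l hl, hy l hl, add_zero]
      zero_mem' := by intro l _; simp
      smul_mem' := by
        intro c x hx l hl
        have : ∑ i, l i * (c • x) i = c * ∑ i, l i * x i := by
          rw [Finset.mul_sum]
          refine Finset.sum_congr rfl fun i _ => ?_
          simp only [Pi.smul_apply, smul_eq_mul]; ring
        rw [this, hx l hl, mul_zero] }
  have hspan := span_rational Λ L (fun q => Iff.rfl)
  let S : Set (Fin n → ℂ) := {z | ∀ l ∈ Λ, ∑ i, (l i : ℂ) * (z i - a i) = 0}
  have hSalg : IsAlgebraicSet S := by
    refine ⟨(fun l : Fin n → ℚ => ∑ i, MvPolynomial.C (l i : ℂ) *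
      (MvPolynomial.X i - MvPolynomial.C (a i))) '' Λ, ?_⟩
    ext z
    simp [S]
  have hSirr : IsIrreducibleAlgebraicSet S := by
    refine affine_irreducible S hSalg ⟨a, fun l _ => by simp⟩ ?_
    intro x hx y hy t l hl
    have h1 := hx l hl
    have h2 := hy l hl
    have : ∑ i, (l i : ℂ) * (x i + t * (y i - x i) - a i) =
        (1 - t) * ∑ i, (l i : ℂ) * (x i - a i) + t * ∑ i, (l i : ℂ) * (y i - a i) := by
      rw [Finset.mul_sum, Finset.mul_sum, ← Finset.sum_add_distrib]
      refine Finset.sum_congr rfl fun i _ => ?_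
      ring
    rw [this, h1, h2]; simp
  have hSW : S = W := by
    refine hmax S hSirr (fun w hw l hl => hl w hw) ?_
    intro z hz
    refine ⟨fun i => Complex.exp_ne_zero _, fun p hp => ?_⟩
    exact vanish_on_hull W hW a ha p (fun w hw => (hWV hw).2 p hp) z hz
  refine ⟨a, L, ?_⟩
  rw [← hSW]
  ext z
  constructor
  · intro hz
    refine ⟨z - a, (hspan _).2 hz, by simp⟩
  · rintro ⟨x, hx, rfl⟩ l hl
    have := (hspan x).1 hx l hl
    simpa using this
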